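/- Let ρ be a full-rank (positive definite) state on ℂ^d ⊗ ℂ^d. Then for every state σ on ℂ^d ⊗ ℂ^d, one has −Tr(σ·log₂ ρ) + Tr(σ_B·log₂ ρ_B) ≥ S_{A|B}(σ), where σ_B and ρ_B are the partial traces of σ and ρ over the first subsystem. -/

import Mathlib

open scoped Kronecker ComplexOrder
open Matrix

noncomputable section

/-- Base-2 matrix logarithm via the functional calculus: same eigenvectors, eigenvalues
replaced by their base-2 logarithms (junk value `0` on non-Hermitian matrices). -/
def matLog2 {n : Type*} [Fintype n] [DecidableEq n] (M : Matrix n n ℂ) : Matrix n n ℂ :=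
  if h : M.IsHermitian then
    (h.eigenvectorUnitary : Matrix n n ℂ) *
      Matrix.diagonal (fun i => (Real.logb 2 (h.eigenvalues i) : ℂ)) *
      (star (h.eigenvectorUnitary : Matrix n n ℂ))
  else 0

/-- von Neumann entropy `S(M) = −∑ λᵢ log₂ λᵢ` over the eigenvalues of `M`
(the convention `0 · log₂ 0 = 0` holds since `Real.logb 2 0 = 0`). -/
def vnEntropy {n : Type*} [Fintype n] [DecidableEq n] (M : Matrix n n ℂ) : ℝ :=
  if h : M.IsHermitian then -∑ i, h.eigenvalues i * Real.logb 2 (h.eigenvalues i) else 0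

/-- Partial trace over the first subsystem: `(ρ_B)_{k,l} = ∑ i, ρ_{(i,k),(i,l)}`. -/
def ptraceB {d : ℕ} (ρ : Matrix (Fin d × Fin d) (Fin d × Fin d) ℂ) : Matrix (Fin d) (Fin d) ℂ :=
  Matrix.of fun k l => ∑ i, ρ (i, k) (i, l)

/-- Partial trace over the second subsystem: `(ρ_A)_{i,j} = ∑ k, ρ_{(i,k),(j,k)}`. -/
def ptraceA {d : ℕ} (ρ : Matrix (Fin d × Fin d) (Fin d × Fin d) ℂ) : Matrix (Fin d) (Fin d) ℂ :=
  Matrix.of fun i j => ∑ k, ρ (i, k) (j, k)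

/-- Conditional von Neumann entropy `S_{A|B}(ρ) = S(ρ) − S(ρ_B)`. -/
def condEntropy {d : ℕ} (ρ : Matrix (Fin d × Fin d) (Fin d × Fin d) ℂ) : ℝ :=
  vnEntropy ρ - vnEntropy (ptraceB ρ)

/-- A state on `ℂ^d ⊗ ℂ^d`: a positive semidefinite matrix with trace 1. -/
def IsState {d : ℕ} (ρ : Matrix (Fin d × Fin d) (Fin d × Fin d) ℂ) : Prop :=
  ρ.PosSemidef ∧ ρ.trace = 1

/-! ### Relative entropies of weighted families from their resolvent sums -/

section Scalar

open Filter Topology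

lemma tendsto_mul_log_add_mul_sub {s r : ℝ} (hs : 0 ≤ s) (hr : 0 < r) :
    Tendsto (fun t : ℝ => s * (Real.log (r + t * s) - Real.log r) - s * Real.log t) atTop
      (𝓝 (s * (Real.log s - Real.log r))) := by
  rcases hs.eq_or_lt with rfl | hs
  · simp
  have hlim : Tendsto (fun t : ℝ => r / t + s) atTop (𝓝 s) := by
    simpa using (tendsto_const_nhds.div_atTop tendsto_id).add_const s
  refine (((hlim.log hs.ne').sub_const (Real.log r)).const_mul s).congr' ?_
  filter_upwards [eventually_gt_atTop 0] with t ht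
  have h : r / t + s = (r + t * s) / t := by field_simp
  rw [h, Real.log_div (by positivity) ht.ne']
  ring

variable {ι κ : Type*} [Fintype ι] [Fintype κ]

lemma hasDerivAt_sum_mul_log {w s r : ι → ℝ} (hs : ∀ i, 0 ≤ s i) (hr : ∀ i, 0 < r i) {t : ℝ}
    (ht : 0 ≤ t) :
    HasDerivAt (fun t : ℝ => ∑ i, w i * (s i * (Real.log (r i + t * s i) - Real.log (r i))))
      (∑ i, w i * (s i ^ 2 / (r i + t * s i))) t := by
  refine HasDerivAt.fun_sum fun i _ => ?_
  have hpos : 0 < r i + t * s i := add_pos_of_pos_of_nonneg (hr i) (mul_nonneg ht (hs i))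
  have h := ((((hasDerivAt_id t).mul_const (s i)).const_add (r i)).log hpos.ne').sub_const
    (Real.log (r i))
  refine ((h.const_mul (s i)).const_mul (w i)).congr_deriv ?_
  rw [id]
  ring

/-- Domination of the sums `∑ w s² / (r + t s)` for every `t > 0` implies domination of the
relative entropies `∑ w s (log s - log r)`, by integrating over `t`. -/
lemma sum_mul_log_sub_log_le {w s r : ι → ℝ} {w' s' r' : κ → ℝ}
    (hs : ∀ i, 0 ≤ s i) (hr : ∀ i, 0 < r i) (hs' : ∀ i, 0 ≤ s' i) (hr' : ∀ i, 0 < r' i)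
    (hsum : ∑ i, w' i * s' i = ∑ i, w i * s i)
    (h : ∀ t > 0, ∑ i, w' i * (s' i ^ 2 / (r' i + t * s' i)) ≤
      ∑ i, w i * (s i ^ 2 / (r i + t * s i))) :
    ∑ i, w' i * (s' i * (Real.log (s' i) - Real.log (r' i))) ≤
      ∑ i, w i * (s i * (Real.log (s i) - Real.log (r i))) := by
  have hd := fun (t : ℝ) (ht : 0 ≤ t) =>
    (hasDerivAt_sum_mul_log (w := w) hs hr ht).sub (hasDerivAt_sum_mul_log (w := w') hs' hr' ht)
  have hmono := monotoneOn_of_deriv_nonneg (convex_Ici (0 : ℝ))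
    (fun t ht => (hd t ht).continuousAt.continuousWithinAt)
    (fun t ht => (hd t (interior_subset ht)).differentiableAt.differentiableWithinAt)
    (fun t ht => by
      rw [interior_Ici] at ht
      rw [(hd t (le_of_lt ht)).deriv]
      exact sub_nonneg.2 (h t ht))
  have hlim : Tendsto (fun t : ℝ => ∑ i, w i * (s i * (Real.log (r i + t * s i) - Real.log (r i))
      - s i * Real.log t)) atTop (𝓝 (∑ i, w i * (s i * (Real.log (s i) - Real.log (r i))))) :=
    tendsto_finsetSum _ fun i _ => (tendsto_mul_log_add_mul_sub (hs i) (hr i)).const_mul _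
  have hlim' : Tendsto (fun t : ℝ => ∑ i, w' i * (s' i * (Real.log (r' i + t * s' i) -
      Real.log (r' i)) - s' i * Real.log t)) atTop
      (𝓝 (∑ i, w' i * (s' i * (Real.log (s' i) - Real.log (r' i))))) :=
    tendsto_finsetSum _ fun i _ => (tendsto_mul_log_add_mul_sub (hs' i) (hr' i)).const_mul _
  refine le_of_tendsto_of_tendsto hlim' hlim ?_
  filter_upwards [eventually_ge_atTop 0] with t ht
  have h0 := hmono Set.self_mem_Ici (Set.mem_Ici.2 ht) ht
  simp only [Pi.sub_apply, zero_mul, add_zero, sub_self, mul_zero, Finset.sum_const_zero] at h0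
  simp only [mul_sub (w _), mul_sub (w' _), Finset.sum_sub_distrib, ← mul_assoc,
    ← Finset.sum_mul, hsum] at h0 ⊢
  linarith

lemma two_mul_re_sub_le {s r t : ℝ} (hpos : 0 < r + t * s) (z m : ℂ) :
    2 * (s * (star z * m).re) - (r + t * s) * ‖m‖ ^ 2 ≤ ‖z‖ ^ 2 * (s ^ 2 / (r + t * s)) := by
  rw [← mul_div_assoc, le_div_iff₀ hpos]
  simp only [Complex.sq_norm, Complex.normSq_apply, Complex.mul_re, Complex.star_def,
    Complex.conj_re, Complex.conj_im]
  nlinarith [sq_nonneg ((r + t * s) * m.re - s * z.re), sq_nonneg ((r + t * s) * m.im - s * z.im)]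

end Scalar

/-! ### Traces in eigenbases -/

section Spectral

variable {n : Type*} [Fintype n]

lemma mul_conjTranspose_apply_re (M : Matrix n n ℂ) (i : n) :
    ((M * Mᴴ) i i).re = ∑ j, ‖M i j‖ ^ 2 := by
  simp [mul_apply, Complex.mul_conj, Complex.normSq_eq_norm_sq, -Complex.ofReal_pow]

lemma conjTranspose_mul_apply_re (M : Matrix n n ℂ) (j : n) :
    ((Mᴴ * M) j j).re = ∑ i, ‖M i j‖ ^ 2 := by
  simp [mul_apply, mul_comm, Complex.mul_conj, Complex.normSq_eq_norm_sq, -Complex.ofReal_pow]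

variable [DecidableEq n]

/-- The matrix with eigenbasis the columns of `U` and real eigenvalues `s`. -/
def conjDiagonal (U : unitaryGroup n ℂ) (s : n → ℝ) : Matrix n n ℂ :=
  (U : Matrix n n ℂ) * diagonal (fun i => (s i : ℂ)) * star (U : Matrix n n ℂ)

lemma Matrix.IsHermitian.eq_conjDiagonal {A : Matrix n n ℂ} (hA : A.IsHermitian) :
    A = conjDiagonal hA.eigenvectorUnitary hA.eigenvalues := by
  conv_lhs => rw [hA.spectral_theorem, Unitary.conjStarAlgAut_apply]
  rfl

lemma matLog2_eq_conjDiagonal {A : Matrix n n ℂ} (hA : A.IsHermitian) :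
    matLog2 A = conjDiagonal hA.eigenvectorUnitary (fun i => Real.logb 2 (hA.eigenvalues i)) := by
  rw [matLog2, dif_pos hA]
  rfl

/-- The quadratic functional whose supremum over `Y` is the resolvent sum at `t`. -/
def resolventForm (A B : Matrix n n ℂ) (t : ℝ) (Y : Matrix n n ℂ) : ℝ :=
  2 * (A * Y).trace.re - (B * (Y * Yᴴ)).trace.re - t * (A * (Yᴴ * Y)).trace.re

lemma trace_diagonal_mul_re (s : n → ℝ) (M : Matrix n n ℂ) :
    (diagonal (fun i => (s i : ℂ)) * M).trace.re = ∑ i, s i * (M i i).re := by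
  simp [trace, diagonal_mul]

lemma trace_conjDiagonal_mul_re (U : unitaryGroup n ℂ) (s : n → ℝ) (M : Matrix n n ℂ) :
    (conjDiagonal U s * M).trace.re =
      ∑ i, s i * ((star (U : Matrix n n ℂ) * M * (U : Matrix n n ℂ)) i i).re := by
  rw [← trace_diagonal_mul_re, conjDiagonal, mul_assoc, mul_assoc, trace_mul_comm]
  simp only [mul_assoc]

variable (U V : unitaryGroup n ℂ) (s r : n → ℝ)

/-- `|⟨u_i, v_j⟩|²` for the orthonormal bases given by the columns of `U` and `V`. -/
def overlap (p : n × n) : ℝ :=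
  ‖(star (U : Matrix n n ℂ) * (V : Matrix n n ℂ)) p.1 p.2‖ ^ 2

lemma sum_overlap_left (j : n) : ∑ i, overlap U V (i, j) = 1 := by
  have h := conjTranspose_mul_apply_re (star (U : Matrix n n ℂ) * (V : Matrix n n ℂ)) j
  have hU : (U : Matrix n n ℂ) * star (U : Matrix n n ℂ) = 1 := Unitary.coe_mul_star_self U
  have hV : star (V : Matrix n n ℂ) * (V : Matrix n n ℂ) = 1 := Unitary.coe_star_mul_self V
  simp only [overlap, ← h]
  rw [← star_eq_conjTranspose, star_mul, star_star, mul_assoc, ← mul_assoc (U : Matrix n n ℂ), hU,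
    one_mul, hV]
  simp

lemma sum_overlap_mul (f : n → ℝ) : ∑ p : n × n, overlap U V p * f p.2 = ∑ j, f j := by
  rw [Fintype.sum_prod_type_right]
  simp [← Finset.sum_mul, sum_overlap_left]

lemma trace_conjDiagonal_mul_conjDiagonal_re :
    (conjDiagonal V s * conjDiagonal U r).trace.re =
      ∑ p : n × n, overlap U V p * (s p.2 * r p.1) := by
  rw [trace_conjDiagonal_mul_re, Fintype.sum_prod_type_right]
  refine Finset.sum_congr rfl fun j _ => ?_
  have h : star (V : Matrix n n ℂ) * conjDiagonal U r * (V : Matrix n n ℂ) =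
      (star (U : Matrix n n ℂ) * (V : Matrix n n ℂ))ᴴ * (diagonal (fun i => (r i : ℂ)) *
        (star (U : Matrix n n ℂ) * (V : Matrix n n ℂ))) := by
    simp only [conjDiagonal, ← star_eq_conjTranspose, star_mul, star_star, mul_assoc]
  rw [h, mul_apply, Complex.re_sum, Finset.mul_sum]
  refine Finset.sum_congr rfl fun i _ => ?_
  rw [diagonal_mul, conjTranspose_apply, overlap, Complex.sq_norm, Complex.normSq_apply]
  simp
  ring

/-- `resolventForm` in terms of the matrix `M` of `Y` in the eigenbases. -/
lemma resolventForm_conjDiagonal (t : ℝ) (M : Matrix n n ℂ) :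
    resolventForm (conjDiagonal V s) (conjDiagonal U r) t
        ((U : Matrix n n ℂ) * M * star (V : Matrix n n ℂ)) =
      ∑ p : n × n, (2 * (s p.2 * (star ((star (U : Matrix n n ℂ) * (V : Matrix n n ℂ)) p.1 p.2)
        * M p.1 p.2).re) - (r p.1 + t * s p.2) * ‖M p.1 p.2‖ ^ 2) := by
  have hU : star (U : Matrix n n ℂ) * (U : Matrix n n ℂ) = 1 := Unitary.coe_star_mul_self U
  have hV : star (V : Matrix n n ℂ) * (V : Matrix n n ℂ) = 1 := Unitary.coe_star_mul_self V
  have h₁ : star (V : Matrix n n ℂ) * ((U : Matrix n n ℂ) * M * star (V : Matrix n n ℂ)) *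
      (V : Matrix n n ℂ) = (star (U : Matrix n n ℂ) * (V : Matrix n n ℂ))ᴴ * M := by
    simp only [← star_eq_conjTranspose, star_mul, star_star, mul_assoc, hV, mul_one]
  have h₂ : star (U : Matrix n n ℂ) * (((U : Matrix n n ℂ) * M * star (V : Matrix n n ℂ)) *
      ((U : Matrix n n ℂ) * M * star (V : Matrix n n ℂ))ᴴ) * (U : Matrix n n ℂ) = M * Mᴴ := by
    simp only [← star_eq_conjTranspose, star_mul, star_star, mul_assoc, hU, mul_one]
    rw [← mul_assoc (star (U : Matrix n n ℂ)), hU, one_mul,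
      ← mul_assoc (star (V : Matrix n n ℂ)) (V : Matrix n n ℂ), hV, one_mul]
  have h₃ : star (V : Matrix n n ℂ) * (((U : Matrix n n ℂ) * M * star (V : Matrix n n ℂ))ᴴ *
      ((U : Matrix n n ℂ) * M * star (V : Matrix n n ℂ))) * (V : Matrix n n ℂ) = Mᴴ * M := by
    simp only [← star_eq_conjTranspose, star_mul, star_star, mul_assoc, hV, mul_one]
    rw [← mul_assoc (star (V : Matrix n n ℂ)), hV, one_mul,
      ← mul_assoc (star (U : Matrix n n ℂ)) (U : Matrix n n ℂ), hU, one_mul]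
  rw [resolventForm, trace_conjDiagonal_mul_re, trace_conjDiagonal_mul_re,
    trace_conjDiagonal_mul_re, h₁, h₂, h₃]
  simp only [mul_conjTranspose_apply_re, conjTranspose_mul_apply_re]
  simp only [add_mul, Finset.sum_sub_distrib, ← sub_sub]
  congr 1
  · congr 1
    · rw [Fintype.sum_prod_type_right, Finset.mul_sum]
      simp only [mul_apply, conjTranspose_apply, Complex.re_sum, Finset.mul_sum]
    · rw [Fintype.sum_prod_type]
      simp only [Finset.mul_sum]
  · rw [Fintype.sum_prod_type_right]
    simp only [Finset.mul_sum, mul_assoc]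

lemma resolventForm_le {s r : n → ℝ} (hs : ∀ j, 0 ≤ s j) (hr : ∀ i, 0 < r i) {t : ℝ} (ht : 0 ≤ t)
    (Y : Matrix n n ℂ) :
    resolventForm (conjDiagonal V s) (conjDiagonal U r) t Y ≤
      ∑ p : n × n, overlap U V p * (s p.2 ^ 2 / (r p.1 + t * s p.2)) := by
  have hU : (U : Matrix n n ℂ) * star (U : Matrix n n ℂ) = 1 := Unitary.coe_mul_star_self U
  have hV : (V : Matrix n n ℂ) * star (V : Matrix n n ℂ) = 1 := Unitary.coe_mul_star_self V
  have hY : Y = (U : Matrix n n ℂ) * (star (U : Matrix n n ℂ) * Y * (V : Matrix n n ℂ)) *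
      star (V : Matrix n n ℂ) := by
    simp only [mul_assoc, hV, mul_one]
    rw [← mul_assoc, hU, one_mul]
  rw [hY, resolventForm_conjDiagonal]
  exact Finset.sum_le_sum fun p _ => two_mul_re_sub_le
    (add_pos_of_pos_of_nonneg (hr _) (mul_nonneg ht (hs _))) _ _

lemma exists_resolventForm_eq {s r : n → ℝ} (hs : ∀ j, 0 ≤ s j) (hr : ∀ i, 0 < r i) {t : ℝ}
    (ht : 0 ≤ t) :
    ∃ Y, resolventForm (conjDiagonal V s) (conjDiagonal U r) t Y =
      ∑ p : n × n, overlap U V p * (s p.2 ^ 2 / (r p.1 + t * s p.2)) := by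
  refine ⟨_, (resolventForm_conjDiagonal U V s r t (of fun i j => ((s j / (r i + t * s j) : ℝ) : ℂ) *
    (star (U : Matrix n n ℂ) * (V : Matrix n n ℂ)) i j)).trans
    (Finset.sum_congr rfl fun p _ => ?_)⟩
  have hpos : 0 < r p.1 + t * s p.2 := add_pos_of_pos_of_nonneg (hr _) (mul_nonneg ht (hs _))
  rw [overlap, of_apply]
  generalize r p.1 + t * s p.2 = c at hpos ⊢
  generalize (star (U : Matrix n n ℂ) * (V : Matrix n n ℂ)) p.1 p.2 = z
  simp only [Complex.sq_norm, Complex.normSq_apply, Complex.mul_re, Complex.mul_im,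
    Complex.star_def, Complex.conj_re, Complex.conj_im, Complex.ofReal_re, Complex.ofReal_im]
  field_simp [hpos.ne']
  ring

end Spectral

/-! ### Monotonicity of the relative entropy under the partial trace -/

section PartialTrace

lemma neg_vnEntropy_sub_trace_mul_matLog2_re {n : Type*} [Fintype n] [DecidableEq n]
    {A B : Matrix n n ℂ} (hA : A.IsHermitian) (hB : B.IsHermitian) :
    -vnEntropy A - (A * matLog2 B).trace.re =
      (∑ p : n × n, overlap hB.eigenvectorUnitary hA.eigenvectorUnitary p *
        (hA.eigenvalues p.2 * (Real.log (hA.eigenvalues p.2) - Real.log (hB.eigenvalues p.1)))) /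
        Real.log 2 := by
  have htr : (A * matLog2 B).trace.re =
      ∑ p : n × n, overlap hB.eigenvectorUnitary hA.eigenvectorUnitary p *
        (hA.eigenvalues p.2 * Real.logb 2 (hB.eigenvalues p.1)) := by
    rw [matLog2_eq_conjDiagonal hB]
    nth_rw 1 [hA.eq_conjDiagonal]
    exact trace_conjDiagonal_mul_conjDiagonal_re _ _ _ _
  rw [htr, vnEntropy, dif_pos hA, neg_neg, ← sum_overlap_mul hB.eigenvectorUnitary
    hA.eigenvectorUnitary, ← Finset.sum_sub_distrib, Finset.sum_div]
  refine Finset.sum_congr rfl fun p _ => ?_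
  simp only [Real.logb]
  ring

variable {d : ℕ}

lemma ptraceB_eq_sum (ρ : Matrix (Fin d × Fin d) (Fin d × Fin d) ℂ) :
    ptraceB ρ = ∑ i, ρ.submatrix (Prod.mk i) (Prod.mk i) := by
  ext k l
  simp [ptraceB, Matrix.sum_apply]

lemma Matrix.PosSemidef.ptraceB {ρ : Matrix (Fin d × Fin d) (Fin d × Fin d) ℂ}
    (hρ : ρ.PosSemidef) : (ptraceB ρ).PosSemidef := by
  rw [ptraceB_eq_sum]
  exact posSemidef_sum _ fun i _ => hρ.submatrix _

lemma Matrix.PosDef.ptraceB (hd : 0 < d) {ρ : Matrix (Fin d × Fin d) (Fin d × Fin d) ℂ}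
    (hρ : ρ.PosDef) : (ptraceB ρ).PosDef := by
  have : Nonempty (Fin d) := ⟨⟨0, hd⟩⟩
  rw [ptraceB_eq_sum]
  exact posDef_sum Finset.univ_nonempty fun i _ => hρ.submatrix (Prod.mk_right_injective i)

lemma trace_mul_one_kronecker (ρ : Matrix (Fin d × Fin d) (Fin d × Fin d) ℂ)
    (Z : Matrix (Fin d) (Fin d) ℂ) :
    (ρ * ((1 : Matrix (Fin d) (Fin d) ℂ) ⊗ₖ Z)).trace = (ptraceB ρ * Z).trace := by
  simp only [trace, diag_apply, mul_apply, kroneckerMap_apply, ptraceB, of_apply,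
    Fintype.sum_prod_type, one_apply, ite_mul, one_mul, zero_mul, mul_ite, mul_zero,
    Finset.sum_mul]
  have h : ∀ i k, ∑ i', ∑ l, (if i' = i then ρ (i, k) (i', l) * Z l k else 0) =
      ∑ l, ρ (i, k) (i, l) * Z l k := fun i k => by
    rw [Finset.sum_comm]
    simp
  simp only [h]
  rw [Finset.sum_comm]
  exact Finset.sum_congr rfl fun k _ => Finset.sum_comm

lemma trace_ptraceB (ρ : Matrix (Fin d × Fin d) (Fin d × Fin d) ℂ) :
    (ptraceB ρ).trace = ρ.trace := by
  simpa using (trace_mul_one_kronecker ρ 1).symm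

lemma resolventForm_one_kronecker (A B : Matrix (Fin d × Fin d) (Fin d × Fin d) ℂ) (t : ℝ)
    (Z : Matrix (Fin d) (Fin d) ℂ) :
    resolventForm A B t ((1 : Matrix (Fin d) (Fin d) ℂ) ⊗ₖ Z) =
      resolventForm (ptraceB A) (ptraceB B) t Z := by
  simp only [resolventForm, conjTranspose_kronecker, conjTranspose_one, ← mul_kronecker_mul,
    one_mul, trace_mul_one_kronecker]

/-- Monotonicity of the quantum relative entropy under the partial trace. -/
lemma relEntropy_ptraceB_le {ρ σ : Matrix (Fin d × Fin d) (Fin d × Fin d) ℂ} (hd : 0 < d)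
    (hρ : ρ.PosDef) (hσ : σ.PosSemidef) :
    -vnEntropy (ptraceB σ) - (ptraceB σ * matLog2 (ptraceB ρ)).trace.re ≤
      -vnEntropy σ - (σ * matLog2 ρ).trace.re := by
  have hρB := hρ.ptraceB hd
  have hσB := hσ.ptraceB
  rw [neg_vnEntropy_sub_trace_mul_matLog2_re hσ.isHermitian hρ.isHermitian,
    neg_vnEntropy_sub_trace_mul_matLog2_re hσB.isHermitian hρB.isHermitian]
  refine div_le_div_of_nonneg_right ?_ (Real.log_nonneg one_le_two)
  refine sum_mul_log_sub_log_le (fun p => hσ.eigenvalues_nonneg p.2)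
    (fun p => hρ.eigenvalues_pos p.1) (fun p => hσB.eigenvalues_nonneg p.2)
    (fun p => hρB.eigenvalues_pos p.1) ?_ fun t ht => ?_
  · rw [sum_overlap_mul, sum_overlap_mul]
    have h := trace_ptraceB σ
    rw [hσ.isHermitian.trace_eq_sum_eigenvalues, hσB.isHermitian.trace_eq_sum_eigenvalues] at h
    exact_mod_cast h
  · obtain ⟨Z, hZ⟩ := exists_resolventForm_eq hρB.isHermitian.eigenvectorUnitary
      hσB.isHermitian.eigenvectorUnitary hσB.eigenvalues_nonneg hρB.eigenvalues_pos ht.le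
    have hle := resolventForm_le hρ.isHermitian.eigenvectorUnitary
      hσ.isHermitian.eigenvectorUnitary hσ.eigenvalues_nonneg hρ.eigenvalues_pos ht.le
      ((1 : Matrix (Fin d) (Fin d) ℂ) ⊗ₖ Z)
    rw [← hσ.isHermitian.eq_conjDiagonal, ← hρ.isHermitian.eq_conjDiagonal,
      resolventForm_one_kronecker] at hle
    rw [← hσB.isHermitian.eq_conjDiagonal, ← hρB.isHermitian.eq_conjDiagonal] at hZ
    exact hZ.symm.trans_le hle

end PartialTrace

/-- `−Tr(σ log₂ ρ) + Tr(σ_B log₂ ρ_B) ≥ S_{A|B}(σ)` for every state `σ` and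
every full-rank state `ρ`. -/
theorem witness_expectation_ge_condEntropy {d : ℕ} (hd : 0 < d)
    (ρ : Matrix (Fin d × Fin d) (Fin d × Fin d) ℂ) (hρ : ρ.PosDef) (htrρ : ρ.trace = 1)
    (σ : Matrix (Fin d × Fin d) (Fin d × Fin d) ℂ) (hσ : IsState σ) :
    condEntropy σ ≤
      (-(σ * matLog2 ρ).trace + (ptraceB σ * matLog2 (ptraceB ρ)).trace).re := by
  have h := relEntropy_ptraceB_le hd hρ hσ.1
  rw [condEntropy, Complex.add_re, Complex.neg_re]
  linarith
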